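/- Let 𝖠 = D^{−1}A (the random-walk normalized adjacency matrix), let v,u ∈ V with even geodesic distance r = d_G(v,u) > 0, let q ≥ 1 be the number of paths of length r in G between v and u, and let the MPNN depth be m = r/2 with |σ'|≤1 and |σ''|≤1. If the MPNN generates mixing M > 0 among v and u, i.e. there exist an input X and coordinates 1≤α,β≤d with |∂²y^{(m)}(X)/∂x_v^α∂x_u^β| ≥ M, then w ≥ (d_min/c₂)·(M/q)^{1/r}, where d_min is the minimal degree of G. -/

import Mathlib

open scoped BigOperators

noncomputable section

namespace OSQ

variable {n d : ℕ}

/-- componentwise application of the activation function. -/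
def act (σ : ℝ → ℝ) (x : EuclideanSpace ℝ (Fin d)) : EuclideanSpace ℝ (Fin d) :=
  WithLp.toLp 2 (fun i => σ (x i))

/-- node features computed by the MPNN after `t` layers. -/
def mpnn (σ : ℝ → ℝ) (𝒜 : Matrix (Fin n) (Fin n) ℝ)
    (Ω W : ℕ → EuclideanSpace ℝ (Fin d) →L[ℝ] EuclideanSpace ℝ (Fin d))
    (ψ : ℕ → EuclideanSpace ℝ (Fin d) × EuclideanSpace ℝ (Fin d) → EuclideanSpace ℝ (Fin d)) :
    ℕ → (Fin n → EuclideanSpace ℝ (Fin d)) → Fin n → EuclideanSpace ℝ (Fin d)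
  | 0, X, v => X v
  | (t+1), X, v =>
    act σ (Ω (t+1) (mpnn σ 𝒜 Ω W ψ t X v)
      + W (t+1) (∑ u : Fin n, 𝒜 v u • ψ (t+1) (mpnn σ 𝒜 Ω W ψ t X v, mpnn σ 𝒜 Ω W ψ t X u)))

/-- coordinate direction in the input space: a perturbation of entry `β` of the
feature of node `u`. -/
def dir (u : Fin n) (β : Fin d) : Fin n → EuclideanSpace ℝ (Fin d) :=
  Pi.single u (EuclideanSpace.single β 1)

/-- `∂ h_v^{(m),α} / ∂ x_u^β`. -/
def jacEntry (σ : ℝ → ℝ) (𝒜 : Matrix (Fin n) (Fin n) ℝ)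
    (Ω W : ℕ → EuclideanSpace ℝ (Fin d) →L[ℝ] EuclideanSpace ℝ (Fin d))
    (ψ : ℕ → EuclideanSpace ℝ (Fin d) × EuclideanSpace ℝ (Fin d) → EuclideanSpace ℝ (Fin d))
    (m : ℕ) (v u : Fin n) (X : Fin n → EuclideanSpace ℝ (Fin d)) (α β : Fin d) : ℝ :=
  fderiv ℝ (fun Y => mpnn σ 𝒜 Ω W ψ m Y v α) X (dir u β)

/-- `∂² h_i^{(m),α} / ∂ x_v^β ∂ x_u^γ`. -/
def hessEntry (σ : ℝ → ℝ) (𝒜 : Matrix (Fin n) (Fin n) ℝ)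
    (Ω W : ℕ → EuclideanSpace ℝ (Fin d) →L[ℝ] EuclideanSpace ℝ (Fin d))
    (ψ : ℕ → EuclideanSpace ℝ (Fin d) × EuclideanSpace ℝ (Fin d) → EuclideanSpace ℝ (Fin d))
    (m : ℕ) (i v u : Fin n) (X : Fin n → EuclideanSpace ℝ (Fin d)) (α β γ : Fin d) : ℝ :=
  fderiv ℝ (fun Y => fderiv ℝ (fun Z => mpnn σ 𝒜 Ω W ψ m Z i α) Y (dir u γ)) X (dir v β)

/-- graph-level prediction with SUM readout: `y(X) = θᵀ Σ_v h_v^{(m)}`. -/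
def readout (θ : EuclideanSpace ℝ (Fin d)) (σ : ℝ → ℝ) (𝒜 : Matrix (Fin n) (Fin n) ℝ)
    (Ω W : ℕ → EuclideanSpace ℝ (Fin d) →L[ℝ] EuclideanSpace ℝ (Fin d))
    (ψ : ℕ → EuclideanSpace ℝ (Fin d) × EuclideanSpace ℝ (Fin d) → EuclideanSpace ℝ (Fin d))
    (m : ℕ) (X : Fin n → EuclideanSpace ℝ (Fin d)) : ℝ :=
  ∑ α : Fin d, θ α * (∑ v : Fin n, mpnn σ 𝒜 Ω W ψ m X v) α

/-- `∂² y^{(m)} / ∂ x_v^α ∂ x_u^β`. -/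
def mixEntry (θ : EuclideanSpace ℝ (Fin d)) (σ : ℝ → ℝ) (𝒜 : Matrix (Fin n) (Fin n) ℝ)
    (Ω W : ℕ → EuclideanSpace ℝ (Fin d) →L[ℝ] EuclideanSpace ℝ (Fin d))
    (ψ : ℕ → EuclideanSpace ℝ (Fin d) × EuclideanSpace ℝ (Fin d) → EuclideanSpace ℝ (Fin d))
    (m : ℕ) (v u : Fin n) (X : Fin n → EuclideanSpace ℝ (Fin d)) (α β : Fin d) : ℝ :=
  fderiv ℝ (fun Y => fderiv ℝ (fun Z => readout θ σ 𝒜 Ω W ψ m Z) Y (dir u β)) X (dir v α)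

/-- the matrix `S := (ω/w)I + c₁ diag(𝒜 1) + c₂ 𝒜`. -/
def Smat (ω w c₁ c₂ : ℝ) (𝒜 : Matrix (Fin n) (Fin n) ℝ) : Matrix (Fin n) (Fin n) ℝ :=
  (ω / w) • (1 : Matrix (Fin n) (Fin n) ℝ)
    + c₁ • Matrix.diagonal (fun i => ∑ j, 𝒜 i j) + c₂ • 𝒜

/-- `diag(𝒜 1)` : the diagonal matrix of row sums. -/
def rowSumDiag (𝒜 : Matrix (Fin n) (Fin n) ℝ) : Matrix (Fin n) (Fin n) ℝ :=
  Matrix.diagonal (fun i => ∑ j, 𝒜 i j)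

/-- `diag(1ᵀ M)` : the diagonal matrix of column sums. -/
def colSumDiag (M : Matrix (Fin n) (Fin n) ℝ) : Matrix (Fin n) (Fin n) ℝ :=
  Matrix.diagonal (fun j => ∑ i, M i j)

/-- the operator (spectral) norm of a matrix, viewed as a linear map between
Euclidean spaces. -/
def matOpNorm {ι κ : Type*} [Fintype ι] [Fintype κ] [DecidableEq ι] (M : Matrix κ ι ℝ) : ℝ :=
  ‖LinearMap.toContinuousLinearMap (Matrix.toEuclideanLin M)‖


/-- the symmetrically-normalized adjacency matrix `A_sym := D^{-1/2} A D^{-1/2}`. -/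
def Asym (G : SimpleGraph (Fin n)) [DecidableRel G.Adj] : Matrix (Fin n) (Fin n) ℝ :=
  Matrix.diagonal (fun a => (Real.sqrt (G.degree a))⁻¹) * G.adjMatrix ℝ *
    Matrix.diagonal (fun a => (Real.sqrt (G.degree a))⁻¹)

/-- the random-walk normalized adjacency matrix `D^{-1} A`. -/
def Arw (G : SimpleGraph (Fin n)) [DecidableRel G.Adj] : Matrix (Fin n) (Fin n) ℝ :=
  Matrix.diagonal (fun a => ((G.degree a : ℝ))⁻¹) * G.adjMatrix ℝ

abbrev Ev (d : ℕ) := EuclideanSpace ℝ (Fin d)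

lemma fderiv_inv {E F : Type*} [NormedAddCommGroup E] [NormedSpace ℝ E]
    [NormedAddCommGroup F] [NormedSpace ℝ F] (f : E → F) (e : E)
    (h : ∀ Y (s : ℝ), f (Y + s • e) = f Y) (X : E) : fderiv ℝ f X e = 0 := by
  by_cases hd : DifferentiableAt ℝ f X
  · have := hd.lineDeriv_eq_fderiv (v := e)
    rw [← this, lineDeriv]
    simp [h]
  · rw [fderiv_zero_of_not_differentiableAt hd]; simp

/-- mixed second derivative -/
def mix2 {E F : Type*} [NormedAddCommGroup E] [NormedSpace ℝ E]
    [NormedAddCommGroup F] [NormedSpace ℝ F] (f : E → F) (a b : E) (X : E) : F :=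
  fderiv ℝ (fun Y => fderiv ℝ f Y b) X a

section mix
variable {E F H : Type*} [NormedAddCommGroup E] [NormedSpace ℝ E]
    [NormedAddCommGroup F] [NormedSpace ℝ F] [NormedAddCommGroup H] [NormedSpace ℝ H]

lemma mix2_inv_right (f : E → F) (a b X : E)
    (h : ∀ Y (s : ℝ), f (Y + s • b) = f Y) : mix2 f a b X = 0 := by
  have : (fun Y => fderiv ℝ f Y b) = fun _ => 0 := by
    funext Y; exact fderiv_inv f b h Y
  simp [mix2, this]

lemma mix2_inv_left (f : E → F) (a b X : E)
    (h : ∀ Y (s : ℝ), f (Y + s • a) = f Y) : mix2 f a b X = 0 := by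
  apply fderiv_inv
  intro Y s
  have h2 : (fun Z => f (Z + s • a)) = f := by funext Z; exact h Z s
  have := fderiv_comp_add_right (𝕜 := ℝ) (f := f) (x := Y) (s • a)
  rw [← this, h2]

lemma diff_fderiv_apply {f : E → F} (hf : ContDiff ℝ 2 f) (b : E) :
    Differentiable ℝ (fun Y => fderiv ℝ f Y b) := by
  have : ContDiff ℝ 1 (fun Y => fderiv ℝ f Y b) :=
    (hf.fderiv_right (m := 1) (by norm_num)).clm_apply contDiff_const
  exact this.differentiable (by norm_num)

lemma mix2_clm {f : E → F} (hf : ContDiff ℝ 2 f) (L : F →L[ℝ] H) (a b X : E) :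
    mix2 (fun Y => L (f Y)) a b X = L (mix2 f a b X) := by
  have h1 : (fun Y => fderiv ℝ (fun Z => L (f Z)) Y b) = fun Y => L (fderiv ℝ f Y b) := by
    funext Y
    exact congrArg (fun K => K b)
      (L.hasFDerivAt.comp Y (hf.differentiable (by norm_num) Y).hasFDerivAt).fderiv
  unfold mix2
  rw [h1]
  exact congrArg (fun K => K a)
    (L.hasFDerivAt.comp X (diff_fderiv_apply hf b X).hasFDerivAt).fderiv

lemma mix2_add {f g : E → F} (hf : ContDiff ℝ 2 f) (hg : ContDiff ℝ 2 g) (a b X : E) :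
    mix2 (fun Y => f Y + g Y) a b X = mix2 f a b X + mix2 g a b X := by
  have h1 : (fun Y => fderiv ℝ (fun Z => f Z + g Z) Y b)
      = fun Y => fderiv ℝ f Y b + fderiv ℝ g Y b := by
    funext Y
    rw [fderiv_fun_add (hf.differentiable (by norm_num) Y) (hg.differentiable (by norm_num) Y)]
    rfl
  unfold mix2
  rw [h1, fderiv_fun_add (diff_fderiv_apply hf b X) (diff_fderiv_apply hg b X)]
  rfl

lemma mix2_sum {ι : Type*} (s : Finset ι) {f : ι → E → F} (hf : ∀ i, ContDiff ℝ 2 (f i))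
    (a b X : E) :
    mix2 (fun Y => ∑ i ∈ s, f i Y) a b X = ∑ i ∈ s, mix2 (f i) a b X := by
  classical
  induction s using Finset.induction_on with
  | empty => simp [mix2]
  | insert i s hi ih =>
    simp only [Finset.sum_insert hi]
    rw [mix2_add (hf i) (ContDiff.sum fun j _ => hf j), ih]

lemma mix2_scalar {σ : ℝ → ℝ} (hσ : ContDiff ℝ 2 σ) {g : E → ℝ} (hg : ContDiff ℝ 2 g)
    (a b X : E) (h0 : mix2 g a b X = 0) :
    mix2 (fun Y => σ (g Y)) a b X
      = deriv (deriv σ) (g X) * fderiv ℝ g X a * fderiv ℝ g X b := by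
  have dg := hg.differentiable (by norm_num)
  have dσ := hσ.differentiable (by norm_num)
  have dσ' : Differentiable ℝ (deriv σ) :=
    ((contDiff_succ_iff_deriv (n := 1)).1 hσ).2.2.differentiable (by norm_num)
  have h1 : (fun Y => fderiv ℝ (fun Z => σ (g Z)) Y b)
      = fun Y => deriv σ (g Y) * fderiv ℝ g Y b := by
    funext Y
    have := ((dσ (g Y)).hasDerivAt.comp_hasFDerivAt Y (dg Y).hasFDerivAt).fderiv
    rw [show (fun Z => σ (g Z)) = σ ∘ g from rfl, this]
    simp
  unfold mix2 at *
  have h2 := ((dσ' (g X)).hasDerivAt.comp_hasFDerivAt X (dg X).hasFDerivAt)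
  have h3 := (h2.mul (diff_fderiv_apply hg b X).hasFDerivAt).fderiv
  rw [h1]
  have h4 : (fun Y => deriv σ (g Y) * fderiv ℝ g Y b)
    = (deriv σ ∘ g) * (fun Y => fderiv ℝ g Y b) := rfl
  rw [h4, h3]
  simp [h0]
  ring

end mix

section net
variable (σ : ℝ → ℝ) (𝒜 : Matrix (Fin n) (Fin n) ℝ)
    (Ω W : ℕ → EuclideanSpace ℝ (Fin d) →L[ℝ] EuclideanSpace ℝ (Fin d))
    (ψ : ℕ → EuclideanSpace ℝ (Fin d) × EuclideanSpace ℝ (Fin d) → EuclideanSpace ℝ (Fin d))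

/-- preactivation -/
def pre (t : ℕ) (X : Fin n → EuclideanSpace ℝ (Fin d)) (v : Fin n) : EuclideanSpace ℝ (Fin d) :=
  Ω (t+1) (mpnn σ 𝒜 Ω W ψ t X v)
      + W (t+1) (∑ u : Fin n, 𝒜 v u • ψ (t+1) (mpnn σ 𝒜 Ω W ψ t X v, mpnn σ 𝒜 Ω W ψ t X u))

lemma mpnn_succ (t : ℕ) (X : Fin n → EuclideanSpace ℝ (Fin d)) (v : Fin n) :
    mpnn σ 𝒜 Ω W ψ (t+1) X v = act σ (pre σ 𝒜 Ω W ψ t X v) := rfl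

lemma pre_contDiff_aux (hψ : ∀ t, ContDiff ℝ 2 (ψ t)) (t : ℕ)
    (h : ∀ v, ContDiff ℝ 2 (fun X => mpnn σ 𝒜 Ω W ψ t X v)) (v : Fin n) :
    ContDiff ℝ 2 (fun X => pre σ 𝒜 Ω W ψ t X v) := by
  unfold pre
  refine ((Ω (t+1)).contDiff.comp (h v)).add ((W (t+1)).contDiff.comp ?_)
  refine ContDiff.sum fun j _ => ?_
  exact ((hψ (t+1)).comp ((h v).prodMk (h j))).const_smul _

lemma act_contDiff {σ : ℝ → ℝ} (hσ : ContDiff ℝ 2 σ) :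
    ContDiff ℝ 2 (act σ : Ev d → Ev d) := by
  rw [contDiff_euclidean]
  intro i
  exact hσ.comp (EuclideanSpace.proj (𝕜 := ℝ) i).contDiff

lemma mpnn_contDiff (hσ : ContDiff ℝ 2 σ) (hψ : ∀ t, ContDiff ℝ 2 (ψ t)) (t : ℕ) (v : Fin n) :
    ContDiff ℝ 2 (fun X => mpnn σ 𝒜 Ω W ψ t X v) := by
  induction t generalizing v with
  | zero => exact contDiff_apply ℝ _ v
  | succ t ih => exact (act_contDiff hσ).comp (pre_contDiff_aux σ 𝒜 Ω W ψ hψ t ih v)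

lemma pre_contDiff (hσ : ContDiff ℝ 2 σ) (hψ : ∀ t, ContDiff ℝ 2 (ψ t)) (t : ℕ) (v : Fin n) :
    ContDiff ℝ 2 (fun X => pre σ 𝒜 Ω W ψ t X v) :=
  pre_contDiff_aux σ 𝒜 Ω W ψ hψ t (mpnn_contDiff σ 𝒜 Ω W ψ hσ hψ t) v

lemma mpnn_local (G : SimpleGraph (Fin n)) (hconn : G.Connected)
    (h𝒜 : ∀ i j, ¬ G.Adj i j → 𝒜 i j = 0) (v : Fin n) (β : Fin d) (t : ℕ) :
    ∀ i, t < G.dist i v → ∀ Y (s : ℝ),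
      mpnn σ 𝒜 Ω W ψ t (Y + s • dir v β) i = mpnn σ 𝒜 Ω W ψ t Y i := by
  induction t with
  | zero =>
    intro i hi Y s
    have : i ≠ v := by rintro rfl; simp at hi
    simp [mpnn, dir, this]
  | succ t ih =>
    intro i hi Y s
    rw [mpnn_succ, mpnn_succ]
    unfold pre
    rw [ih i (by omega) Y s]
    congr 3
    refine Finset.sum_congr rfl fun j _ => ?_
    by_cases hadj : G.Adj i j
    · have h1 := hconn.dist_triangle (u := i) (v := j) (w := v)
      rw [SimpleGraph.dist_eq_one_iff_adj.2 hadj] at h1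
      rw [ih j (by omega) Y s]
    · simp [h𝒜 i j hadj]

lemma act_fderiv_norm {σ : ℝ → ℝ} (hσ : ContDiff ℝ 2 σ) (hσ' : ∀ x, |deriv σ x| ≤ 1)
    {E : Type*} [NormedAddCommGroup E] [NormedSpace ℝ E] {f : E → Ev d} (hf : ContDiff ℝ 2 f)
    (X e : E) : ‖fderiv ℝ (fun Y => act σ (f Y)) X e‖ ≤ ‖fderiv ℝ f X e‖ := by
  have hd : DifferentiableAt ℝ (fun Y => act σ (f Y)) X :=
    ((act_contDiff hσ).comp hf).differentiable (by norm_num) X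
  have hfd := hf.differentiable (by norm_num) X
  have key : ∀ i, (fderiv ℝ (fun Y => act σ (f Y)) X e) i
      = deriv σ (f X i) * (fderiv ℝ f X e) i := by
    intro i
    have h1 := ((EuclideanSpace.proj i : Ev d →L[ℝ] ℝ).hasFDerivAt.comp X
      hd.hasFDerivAt).fderiv
    have h2 := (EuclideanSpace.proj i : Ev d →L[ℝ] ℝ).hasFDerivAt.comp X
      hfd.hasFDerivAt
    have h3 := (((hσ.differentiable (by norm_num)) (f X i)).hasDerivAt.comp_hasFDerivAt X h2).fderiv
    have h4 := h1.symm.trans h3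
    have := congrArg (fun L => L e) h4
    simpa using this
  rw [EuclideanSpace.norm_eq, EuclideanSpace.norm_eq]
  apply Real.sqrt_le_sqrt
  refine Finset.sum_le_sum fun i _ => ?_
  rw [key, norm_mul, mul_pow]
  have : ‖deriv σ (f X i)‖ ^ 2 ≤ 1 := pow_le_one₀ (norm_nonneg _) (hσ' _)
  nlinarith [sq_nonneg ‖(fderiv ℝ f X e) i‖]

lemma pre_fderiv_norm (G : SimpleGraph (Fin n)) (hconn : G.Connected)
    (h𝒜 : ∀ i j, ¬ G.Adj i j → 𝒜 i j = 0) (h𝒜0 : ∀ i j, 0 ≤ 𝒜 i j)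
    (hσ : ContDiff ℝ 2 σ) (hψ : ∀ t, ContDiff ℝ 2 (ψ t))
    (w c₂ : ℝ) (hw : 0 < w) (hc₂ : 0 < c₂) (hW : ∀ t, ‖W t‖ ≤ w)
    (hψ₂ : ∀ t x y, ‖fderiv ℝ (fun z => ψ t (x, z)) y‖ ≤ c₂)
    (v : Fin n) (β : Fin d) (X : Fin n → EuclideanSpace ℝ (Fin d)) (t : ℕ)
    (ih : ∀ i, t ≤ G.dist i v →
      ‖fderiv ℝ (fun Y => mpnn σ 𝒜 Ω W ψ t Y i) X (dir v β)‖ ≤ (w * c₂) ^ t * (𝒜 ^ t) i v)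
    (i : Fin n) (hi : t + 1 ≤ G.dist i v) :
    ‖fderiv ℝ (fun Y => pre σ 𝒜 Ω W ψ t Y i) X (dir v β)‖
      ≤ (w * c₂) ^ (t+1) * (𝒜 ^ (t+1)) i v := by
  have hD : ∀ j, DifferentiableAt ℝ (fun Y => mpnn σ 𝒜 Ω W ψ t Y j) X := fun j =>
    (mpnn_contDiff σ 𝒜 Ω W ψ hσ hψ t j).differentiable (by norm_num) X
  have hzero : fderiv ℝ (fun Y => mpnn σ 𝒜 Ω W ψ t Y i) X (dir v β) = 0 :=
    fderiv_inv _ _ (mpnn_local σ 𝒜 Ω W ψ G hconn h𝒜 v β t i (by omega)) X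
  have hψd : ∀ p, DifferentiableAt ℝ (ψ (t+1)) p := (hψ (t+1)).differentiable (by norm_num)
  have hterm : ∀ j, HasFDerivAt (fun Y => 𝒜 i j • ψ (t+1) (mpnn σ 𝒜 Ω W ψ t Y i, mpnn σ 𝒜 Ω W ψ t Y j))
      (𝒜 i j • (fderiv ℝ (ψ (t+1)) (mpnn σ 𝒜 Ω W ψ t X i, mpnn σ 𝒜 Ω W ψ t X j)).comp
        ((fderiv ℝ (fun Y => mpnn σ 𝒜 Ω W ψ t Y i) X).prod
          (fderiv ℝ (fun Y => mpnn σ 𝒜 Ω W ψ t Y j) X))) X := by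
    intro j
    have := (hψd (mpnn σ 𝒜 Ω W ψ t X i, mpnn σ 𝒜 Ω W ψ t X j)).hasFDerivAt.comp X
      ((hD i).hasFDerivAt.prodMk (hD j).hasFDerivAt)
    exact this.const_smul (𝒜 i j)
  have hsum := HasFDerivAt.fun_sum (u := Finset.univ) (fun j _ => hterm j)
  have hall := ((Ω (t+1)).hasFDerivAt.comp X (hD i).hasFDerivAt).add
    ((W (t+1)).hasFDerivAt.comp X hsum)
  have hpart : ∀ x y e, fderiv ℝ (ψ (t+1)) (x, y) (0, e)
      = fderiv ℝ (fun z => ψ (t+1) (x, z)) y e := by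
    intro x y e
    have h1 : HasFDerivAt (fun z : Ev d => (x, z)) (ContinuousLinearMap.inr ℝ (Ev d) (Ev d)) y :=
      hasFDerivAt_prodMk_right x y
    have := ((hψd (x, y)).hasFDerivAt.comp y h1).fderiv
    have h2 := congrArg (fun L => L e) this
    simpa [Function.comp_def] using h2.symm
  have heq : fderiv ℝ (fun Y => pre σ 𝒜 Ω W ψ t Y i) X (dir v β)
      = W (t+1) (∑ j, 𝒜 i j • fderiv ℝ (fun z => ψ (t+1) (mpnn σ 𝒜 Ω W ψ t X i, z))
        (mpnn σ 𝒜 Ω W ψ t X j) (fderiv ℝ (fun Y => mpnn σ 𝒜 Ω W ψ t Y j) X (dir v β))) := by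
    have h1 := congrArg (fun L => L (dir v β)) hall.fderiv
    refine Eq.trans h1 ?_
    simp [hzero, hpart]
  rw [heq]
  have hb : ‖∑ j, 𝒜 i j • fderiv ℝ (fun z => ψ (t+1) (mpnn σ 𝒜 Ω W ψ t X i, z))
        (mpnn σ 𝒜 Ω W ψ t X j) (fderiv ℝ (fun Y => mpnn σ 𝒜 Ω W ψ t Y j) X (dir v β))‖
      ≤ ∑ j, 𝒜 i j * (c₂ * ((w * c₂) ^ t * (𝒜 ^ t) j v)) := by
    refine (norm_sum_le _ _).trans (Finset.sum_le_sum fun j _ => ?_)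
    rw [norm_smul, Real.norm_of_nonneg (h𝒜0 i j)]
    by_cases hadj : G.Adj i j
    · have h1 := hconn.dist_triangle (u := i) (v := j) (w := v)
      rw [SimpleGraph.dist_eq_one_iff_adj.2 hadj] at h1
      refine mul_le_mul_of_nonneg_left ?_ (h𝒜0 i j)
      refine (ContinuousLinearMap.le_opNorm _ _).trans ?_
      exact mul_le_mul (hψ₂ _ _ _) (ih j (by omega)) (norm_nonneg _) hc₂.le
    · simp [h𝒜 i j hadj]
  refine (ContinuousLinearMap.le_opNorm _ _).trans ?_
  refine (mul_le_mul (hW _) hb (norm_nonneg _) hw.le).trans (le_of_eq ?_)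
  rw [pow_succ' 𝒜, Matrix.mul_apply, Finset.mul_sum, Finset.mul_sum]
  refine Finset.sum_congr rfl fun j _ => ?_
  ring

lemma mpnn_fderiv_norm (G : SimpleGraph (Fin n)) (hconn : G.Connected)
    (h𝒜 : ∀ i j, ¬ G.Adj i j → 𝒜 i j = 0) (h𝒜0 : ∀ i j, 0 ≤ 𝒜 i j)
    (hσ : ContDiff ℝ 2 σ) (hσ' : ∀ x, |deriv σ x| ≤ 1) (hψ : ∀ t, ContDiff ℝ 2 (ψ t))
    (w c₂ : ℝ) (hw : 0 < w) (hc₂ : 0 < c₂) (hW : ∀ t, ‖W t‖ ≤ w)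
    (hψ₂ : ∀ t x y, ‖fderiv ℝ (fun z => ψ t (x, z)) y‖ ≤ c₂)
    (v : Fin n) (β : Fin d) (X : Fin n → EuclideanSpace ℝ (Fin d)) (t : ℕ) :
    ∀ i, t ≤ G.dist i v →
      ‖fderiv ℝ (fun Y => mpnn σ 𝒜 Ω W ψ t Y i) X (dir v β)‖ ≤ (w * c₂) ^ t * (𝒜 ^ t) i v := by
  induction t with
  | zero =>
    intro i _
    have : fderiv ℝ (fun Y : Fin n → Ev d => mpnn σ 𝒜 Ω W ψ 0 Y i) X (dir v β)
        = (dir v β : Fin n → Ev d) i := by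
      have h := (hasFDerivAt_apply (𝕜 := ℝ) i X).fderiv
      exact congrArg (fun L => L (dir v β)) h
    rw [this]
    by_cases hiv : i = v
    · subst hiv; simp [dir]
    · simp [dir, hiv]
  | succ t ih =>
    intro i hi
    refine le_trans ?_ (pre_fderiv_norm σ 𝒜 Ω W ψ G hconn h𝒜 h𝒜0 hσ hψ w c₂ hw hc₂ hW hψ₂ v β X t
      ih i hi)
    exact act_fderiv_norm hσ hσ' (pre_contDiff σ 𝒜 Ω W ψ hσ hψ t i) X (dir v β)

lemma had_norm {x y z : Ev d} (h : ∀ i, |z i| ≤ |x i| * |y i|) : ‖z‖ ≤ ‖x‖ * ‖y‖ := by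
  rw [EuclideanSpace.norm_eq z, EuclideanSpace.norm_eq y]
  apply Real.sqrt_le_iff.2
  refine ⟨by positivity, ?_⟩
  rw [mul_pow, Real.sq_sqrt (by positivity), Finset.mul_sum]
  refine Finset.sum_le_sum fun i _ => ?_
  have h1 : ‖x i‖ ≤ ‖x‖ := PiLp.norm_apply_le x i
  rw [← mul_pow]
  refine pow_le_pow_left₀ (norm_nonneg _) ?_ 2
  exact (h i).trans (mul_le_mul_of_nonneg_right h1 (abs_nonneg _))

lemma mix2_act {σ : ℝ → ℝ} (hσ : ContDiff ℝ 2 σ) (hσ'' : ∀ x, |deriv (deriv σ) x| ≤ 1)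
    {E : Type*} [NormedAddCommGroup E] [NormedSpace ℝ E] {f : E → Ev d} (hf : ContDiff ℝ 2 f)
    (a b X : E) (h0 : mix2 f a b X = 0) :
    ‖mix2 (fun Y => act σ (f Y)) a b X‖ ≤ ‖fderiv ℝ f X a‖ * ‖fderiv ℝ f X b‖ := by
  apply had_norm
  intro i
  set L := (EuclideanSpace.proj i : Ev d →L[ℝ] ℝ) with hL
  have hLf : ContDiff ℝ 2 (fun Y => L (f Y)) := L.contDiff.comp hf
  have h1 : (mix2 (fun Y => act σ (f Y)) a b X) i = mix2 (fun Y => σ (L (f Y))) a b X := by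
    exact (mix2_clm ((act_contDiff hσ).comp hf) L a b X).symm
  have h2 : mix2 (fun Y => L (f Y)) a b X = 0 := by rw [mix2_clm hf, h0, map_zero]
  have h3 : ∀ e, fderiv ℝ (fun Y => L (f Y)) X e = (fderiv ℝ f X e) i := by
    intro e
    have := (L.hasFDerivAt.comp X (hf.differentiable (by norm_num) X).hasFDerivAt).fderiv
    exact congrArg (fun L => L e) this
  rw [h1, mix2_scalar hσ hLf a b X h2, h3, h3, abs_mul, abs_mul, mul_assoc]
  exact mul_le_of_le_one_left (by positivity) (hσ'' _)

lemma mix2_pre_zero (G : SimpleGraph (Fin n)) (hconn : G.Connected)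
    (h𝒜 : ∀ i j, ¬ G.Adj i j → 𝒜 i j = 0)
    (hσ : ContDiff ℝ 2 σ) (hψ : ∀ t, ContDiff ℝ 2 (ψ t))
    (v u : Fin n) (α β : Fin d) (X : Fin n → EuclideanSpace ℝ (Fin d)) (t : ℕ)
    (hvu : 2 * (t + 1) ≤ G.dist v u) (i : Fin n) (hi : t + 1 ≤ G.dist i v)
    (hi' : t + 1 ≤ G.dist i u) :
    mix2 (fun Y => pre σ 𝒜 Ω W ψ t Y i) (dir v α) (dir u β) X = 0 := by
  have hC := mpnn_contDiff σ 𝒜 Ω W ψ hσ hψ t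
  have hT : ∀ j, ContDiff ℝ 2
      (fun Y => 𝒜 i j • ψ (t+1) (mpnn σ 𝒜 Ω W ψ t Y i, mpnn σ 𝒜 Ω W ψ t Y j)) := fun j =>
    ((hψ (t+1)).comp ((hC i).prodMk (hC j))).const_smul _
  have hlv := mpnn_local σ 𝒜 Ω W ψ G hconn h𝒜 v α t
  have hlu := mpnn_local σ 𝒜 Ω W ψ G hconn h𝒜 u β t
  unfold pre
  have hS : ContDiff ℝ 2 (fun Y => ∑ j,
      𝒜 i j • ψ (t+1) (mpnn σ 𝒜 Ω W ψ t Y i, mpnn σ 𝒜 Ω W ψ t Y j)) :=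
    ContDiff.sum fun j _ => hT j
  have hA := mix2_add ((Ω (t+1)).contDiff.comp (hC i)) ((W (t+1)).contDiff.comp hS)
    (dir v α) (dir u β) X
  refine hA.trans ?_
  simp only [Function.comp_def]
  rw [mix2_clm (hC i), mix2_inv_left _ _ _ _ (hlv i (by omega)),
    mix2_clm hS, mix2_sum _ hT]
  rw [Finset.sum_eq_zero]
  · simp
  intro j _
  have h1 := hconn.dist_triangle (u := v) (v := j) (w := u)
  rw [SimpleGraph.dist_comm (u := v) (v := j)] at h1
  by_cases hj : t < G.dist j v
  · apply mix2_inv_left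
    intro Y s
    rw [hlv i (by omega), hlv j hj]
  · apply mix2_inv_right
    intro Y s
    rw [hlu i (by omega), hlu j (by omega)]

lemma mix_bound (G : SimpleGraph (Fin n)) (hconn : G.Connected)
    (h𝒜 : ∀ i j, ¬ G.Adj i j → 𝒜 i j = 0) (h𝒜0 : ∀ i j, 0 ≤ 𝒜 i j)
    (hσ : ContDiff ℝ 2 σ) (hσ' : ∀ x, |deriv σ x| ≤ 1) (hσ'' : ∀ x, |deriv (deriv σ) x| ≤ 1)
    (hψ : ∀ t, ContDiff ℝ 2 (ψ t))
    (w c₂ : ℝ) (hw : 0 < w) (hc₂ : 0 < c₂) (hW : ∀ t, ‖W t‖ ≤ w)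
    (hψ₂ : ∀ t x y, ‖fderiv ℝ (fun z => ψ t (x, z)) y‖ ≤ c₂)
    (θ : EuclideanSpace ℝ (Fin d)) (hθ : ‖θ‖ = 1)
    (v u : Fin n) (α β : Fin d) (X : Fin n → EuclideanSpace ℝ (Fin d)) (t : ℕ)
    (hvu : 2 * (t + 1) ≤ G.dist v u) :
    |mixEntry θ σ 𝒜 Ω W ψ (t+1) v u X α β|
      ≤ ∑ i, ((w * c₂) ^ (t+1) * (𝒜 ^ (t+1)) i v) * ((w * c₂) ^ (t+1) * (𝒜 ^ (t+1)) i u) := by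
  have hC := mpnn_contDiff σ 𝒜 Ω W ψ hσ hψ (t+1)
  have hnn : ∀ k i j, 0 ≤ (𝒜 ^ k) i j := by
    intro k
    induction k with
    | zero => intro i j; rw [pow_zero, Matrix.one_apply]; split_ifs <;> norm_num
    | succ k ih =>
      intro i j; rw [pow_succ, Matrix.mul_apply]
      exact Finset.sum_nonneg fun l _ => mul_nonneg (ih _ _) (h𝒜0 _ _)
  have hread : (fun Z => readout θ σ 𝒜 Ω W ψ (t+1) Z)
      = fun Z => innerSL ℝ θ (∑ i, mpnn σ 𝒜 Ω W ψ (t+1) Z i) := by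
    funext Z
    simp only [readout, innerSL_apply_apply, PiLp.inner_apply]
    refine Finset.sum_congr rfl fun i _ => ?_
    simp [mul_comm]
  have h1 : mixEntry θ σ 𝒜 Ω W ψ (t+1) v u X α β
      = innerSL ℝ θ (∑ i, mix2 (fun Z => mpnn σ 𝒜 Ω W ψ (t+1) Z i) (dir v α) (dir u β) X) := by
    rw [← mix2_sum _ hC, ← mix2_clm (ContDiff.sum fun j _ => hC j), ← hread]
    rfl
  rw [h1, innerSL_apply_apply]
  refine (abs_real_inner_le_norm _ _).trans ?_
  rw [hθ, one_mul]
  refine (norm_sum_le _ _).trans (Finset.sum_le_sum fun i _ => ?_)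
  have hpos : 0 ≤ ((w * c₂) ^ (t+1) * (𝒜 ^ (t+1)) i v) * ((w * c₂) ^ (t+1) * (𝒜 ^ (t+1)) i u) :=
    mul_nonneg (mul_nonneg (by positivity) (hnn _ _ _)) (mul_nonneg (by positivity) (hnn _ _ _))
  by_cases hv : t + 1 < G.dist i v
  · rw [mix2_inv_left _ _ _ _ (mpnn_local σ 𝒜 Ω W ψ G hconn h𝒜 v α (t+1) i hv), norm_zero]
    exact hpos
  by_cases hu : t + 1 < G.dist i u
  · rw [mix2_inv_right _ _ _ _ (mpnn_local σ 𝒜 Ω W ψ G hconn h𝒜 u β (t+1) i hu), norm_zero]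
    exact hpos
  have htri := hconn.dist_triangle (u := v) (v := i) (w := u)
  rw [SimpleGraph.dist_comm (u := v) (v := i)] at htri
  have hv' : t + 1 ≤ G.dist i v := by omega
  have hu' : t + 1 ≤ G.dist i u := by omega
  refine (mix2_act hσ hσ'' (pre_contDiff σ 𝒜 Ω W ψ hσ hψ t i) _ _ X
    (mix2_pre_zero σ 𝒜 Ω W ψ G hconn h𝒜 hσ hψ v u α β X t hvu i hv' hu')).trans ?_
  have hb : ∀ (x : Fin n) (γ : Fin d), t + 1 ≤ G.dist i x →
      ‖fderiv ℝ (fun Y => pre σ 𝒜 Ω W ψ t Y i) X (dir x γ)‖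
      ≤ (w * c₂) ^ (t+1) * (𝒜 ^ (t+1)) i x := fun x γ hx =>
    pre_fderiv_norm σ 𝒜 Ω W ψ G hconn h𝒜 h𝒜0 hσ hψ w c₂ hw hc₂ hW hψ₂ x γ X t
      (mpnn_fderiv_norm σ 𝒜 Ω W ψ G hconn h𝒜 h𝒜0 hσ hσ' hψ w c₂ hw hc₂ hW hψ₂ x γ X t) i hx
  exact mul_le_mul (hb v α hv') (hb u β hu') (norm_nonneg _)
    (mul_nonneg (by positivity) (hnn _ _ _))

end net

section graph
variable (G : SimpleGraph (Fin n)) [DecidableRel G.Adj]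

lemma Arw_apply (i j : Fin n) : Arw G i j = ((G.degree i : ℝ))⁻¹ * G.adjMatrix ℝ i j := by
  rw [Arw, Matrix.diagonal_mul]

lemma adj_nonneg (i j : Fin n) : 0 ≤ G.adjMatrix ℝ i j := by
  rw [SimpleGraph.adjMatrix_apply]; split_ifs <;> norm_num

lemma adj_pow_nonneg (k : ℕ) (i j : Fin n) : 0 ≤ (G.adjMatrix ℝ ^ k) i j := by
  rw [SimpleGraph.adjMatrix_pow_apply_eq_card_walk]; positivity

lemma Arw_nonneg (i j : Fin n) : 0 ≤ Arw G i j := by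
  rw [Arw_apply]; exact mul_nonneg (by positivity) (adj_nonneg G i j)

lemma Arw_pow_bound (hmin : 0 < G.minDegree) (k : ℕ) : ∀ (i j : Fin n),
    0 ≤ (Arw G ^ k) i j ∧
    (Arw G ^ k) i j ≤ ((G.minDegree : ℝ)⁻¹) ^ k * (G.adjMatrix ℝ ^ k) i j := by
  induction k with
  | zero => intro i j; simp [Matrix.one_apply]; split_ifs <;> norm_num
  | succ k ih =>
    intro i j
    rw [pow_succ', pow_succ' (G.adjMatrix ℝ), Matrix.mul_apply, Matrix.mul_apply, Finset.mul_sum]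
    refine ⟨Finset.sum_nonneg fun l _ => mul_nonneg (Arw_nonneg G _ _) (ih _ _).1,
      Finset.sum_le_sum fun l _ => ?_⟩
    have hm : (0:ℝ) < G.minDegree := by exact_mod_cast hmin
    have h1 : Arw G i l ≤ (G.minDegree : ℝ)⁻¹ * G.adjMatrix ℝ i l := by
      rw [Arw_apply]
      refine mul_le_mul_of_nonneg_right ?_ (adj_nonneg G i l)
      apply inv_anti₀ hm
      exact_mod_cast G.minDegree_le_degree i
    refine (mul_le_mul h1 (ih l j).2 (ih l j).1
      (mul_nonneg (by positivity) (adj_nonneg G i l))).trans (le_of_eq ?_)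
    ring

lemma card_paths (v u : Fin n) (r : ℕ) (hr : r = G.dist v u) :
    (G.adjMatrix ℝ ^ r) v u = ({p : G.Walk v u | p.length = r ∧ p.IsPath}.ncard : ℝ) := by
  rw [SimpleGraph.adjMatrix_pow_apply_eq_card_walk]
  have : {p : G.Walk v u | p.length = r ∧ p.IsPath} = {p : G.Walk v u | p.length = r} := by
    ext p
    simp only [Set.mem_ofPred_eq, and_iff_left_iff_imp]
    intro h
    exact p.isPath_of_length_eq_dist (h.trans hr)
  rw [this, ← Nat.card_eq_fintype_card, Nat.card_coe_set_eq]

end graph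

/-- **Statement 6** (Theorem 4.1 for `𝒜 = D⁻¹A`): lower bound on the weight norm
needed to generate mixing `M` at minimal depth `m = r/2`. -/
theorem weight_lower_bound_rw [Nonempty (Fin n)]
    (G : SimpleGraph (Fin n)) [DecidableRel G.Adj] (hconn : G.Connected)
    (σ : ℝ → ℝ) (hσ : ContDiff ℝ 2 σ)
    (hσ' : ∀ x, |deriv σ x| ≤ 1) (hσ'' : ∀ x, |deriv (deriv σ) x| ≤ 1)
    (Ω W : ℕ → EuclideanSpace ℝ (Fin d) →L[ℝ] EuclideanSpace ℝ (Fin d))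
    (ω w : ℝ) (hw : 0 < w) (hΩ : ∀ t, ‖Ω t‖ ≤ ω) (hW : ∀ t, ‖W t‖ ≤ w)
    (ψ : ℕ → EuclideanSpace ℝ (Fin d) × EuclideanSpace ℝ (Fin d) → EuclideanSpace ℝ (Fin d))
    (hψ : ∀ t, ContDiff ℝ 2 (ψ t)) (c₁ c₂ c2 : ℝ) (hc₂ : 0 < c₂)
    (hψ₁ : ∀ t x y, ‖fderiv ℝ (fun z => ψ t (z, y)) x‖ ≤ c₁)
    (hψ₂ : ∀ t x y, ‖fderiv ℝ (fun z => ψ t (x, z)) y‖ ≤ c₂)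
    (hψ₃ : ∀ t p, ‖iteratedFDeriv ℝ 2 (ψ t) p‖ ≤ c2)
    (θ : EuclideanSpace ℝ (Fin d)) (hθ : ‖θ‖ = 1)
    (v u : Fin n) (r : ℕ) (hr : r = G.dist v u) (hrpos : 0 < r) (hreven : Even r)
    (q : ℕ) (hq : q = {p : G.Walk v u | p.length = r ∧ p.IsPath}.ncard) (hq1 : 1 ≤ q)
    (m : ℕ) (hm : m = r / 2)
    (M : ℝ) (hM : 0 < M)
    (X : Fin n → EuclideanSpace ℝ (Fin d)) (α β : Fin d)
    (hmix : M ≤ |OSQ.mixEntry θ σ (Arw G) Ω W ψ m v u X α β|) :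
    (G.minDegree : ℝ) / c₂ * (M / q) ^ ((1 : ℝ) / r) ≤ w := by
  obtain ⟨k, hk⟩ := hreven
  have hmk : m = k := by omega
  subst hmk
  obtain ⟨t, rfl⟩ : ∃ t, m = t + 1 := ⟨m - 1, by omega⟩
  have hvu : v ≠ u := by rintro rfl; simp at hr; omega
  have hmin : 0 < G.minDegree := by
    have : Nontrivial (Fin n) := ⟨v, u, hvu⟩
    exact hconn.preconnected.minDegree_pos_of_nontrivial
  have hmR : (0:ℝ) < G.minDegree := by exact_mod_cast hmin
  have h𝒜 : ∀ i j, ¬ G.Adj i j → Arw G i j = 0 := by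
    intro i j h; rw [Arw_apply]; simp [h]
  have hB := mix_bound σ (Arw G) Ω W ψ G hconn h𝒜 (Arw_nonneg G) hσ hσ' hσ'' hψ w c₂ hw hc₂ hW hψ₂
    θ hθ v u α β X t (by omega)
  have hqR : (0:ℝ) < q := by exact_mod_cast hq1
  have hcount : ∑ i, (G.adjMatrix ℝ ^ (t+1)) i v * (G.adjMatrix ℝ ^ (t+1)) i u = q := by
    rw [hq, ← card_paths G v u r hr, hk, pow_add _ (t+1) (t+1), Matrix.mul_apply]
    refine Finset.sum_congr rfl fun i _ => ?_
    have : ((G.adjMatrix ℝ ^ (t+1))).transpose = G.adjMatrix ℝ ^ (t+1) := by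
      rw [Matrix.transpose_pow, SimpleGraph.transpose_adjMatrix]
    congr 1
    exact congrFun (congrFun this v) i
  have hfin : M ≤ (w * c₂ / G.minDegree) ^ r * q := by
    refine (hmix.trans hB).trans ?_
    rw [← hcount, Finset.mul_sum]
    refine Finset.sum_le_sum fun i _ => ?_
    have b1 := Arw_pow_bound G hmin (t+1) i v
    have b2 := Arw_pow_bound G hmin (t+1) i u
    have hp : 0 ≤ (w * c₂) ^ (t+1) := by positivity
    refine (mul_le_mul (mul_le_mul_of_nonneg_left b1.2 hp) (mul_le_mul_of_nonneg_left b2.2 hp)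
      (mul_nonneg hp b2.1) (mul_nonneg hp (b1.1.trans b1.2))).trans (le_of_eq ?_)
    rw [hk, pow_add, div_eq_mul_inv, mul_pow (w * c₂)]
    ring
  have hroot : (M / q) ^ ((1:ℝ) / r) ≤ w * c₂ / G.minDegree := by
    have h1 : M / q ≤ (w * c₂ / G.minDegree) ^ r := by rwa [div_le_iff₀ hqR]
    have h2 := Real.rpow_le_rpow (by positivity) h1 (z := (1:ℝ)/r) (by positivity)
    rwa [one_div, Real.pow_rpow_inv_natCast (by positivity) (by omega), ← one_div] at h2
  calc (G.minDegree : ℝ) / c₂ * (M / q) ^ ((1 : ℝ) / r)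
      ≤ (G.minDegree : ℝ) / c₂ * (w * c₂ / G.minDegree) := by gcongr
    _ = w := by field_simp
end OSQ
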